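/- Let Q be a cube in ℝ^n with sides parallel to the axes and let r, p₀ satisfy 0 < r < p₀ < ∞. Then the following three sets of measurable functions on Q coincide: (1) 𝓜^r_{A₁}(Q), the functions f such that |f|^r has an A₁(Q) majorant; (2) the union over p > r of L^p(Q); (3) the union over w ∈ A_{p₀/r}(Q) of L^{p₀}_w(Q). -/

import Mathlib

open MeasureTheory ENNReal

/-- A (nondegenerate) cube in `ℝⁿ` with sides parallel to the axes. -/
def IsCube {n : ℕ} (Q : Set (Fin n → ℝ)) : Prop :=
  ∃ (a : Fin n → ℝ) (l : ℝ), 0 < l ∧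
    Q = Set.univ.pi fun i => Set.Icc (a i) (a i + l)

/-- The domains considered: all of `ℝⁿ` or a cube with sides parallel to the axes. -/
def IsAdmissibleDomain {n : ℕ} (Ω : Set (Fin n → ℝ)) : Prop :=
  Ω = Set.univ ∨ IsCube Ω

/-- The Hardy–Littlewood maximal operator restricted to `Ω`:
`M_Ω f (x) = sup { (1/|Q|) ∫_Q |f| : Q ⊆ Ω a cube with x ∈ Q }`. -/
noncomputable def maximal {n : ℕ} (Ω : Set (Fin n → ℝ)) (f : (Fin n → ℝ) → ℝ)
    (x : Fin n → ℝ) : ℝ≥0∞ :=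
  ⨆ (Q : Set (Fin n → ℝ)) (_ : IsCube Q) (_ : Q ⊆ Ω) (_ : x ∈ Q),
    (volume Q)⁻¹ * ∫⁻ y in Q, ENNReal.ofReal |f y|

/-- A weight on `Ω`: a measurable function, positive a.e. on `Ω`, integrable on every
cube contained in `Ω` (hence locally integrable; integrable when `Ω` is itself a cube). -/
structure IsWeight {n : ℕ} (Ω : Set (Fin n → ℝ)) (w : (Fin n → ℝ) → ℝ) : Prop where
  measurable : Measurable w
  pos : ∀ᵐ x ∂(volume.restrict Ω), 0 < w x
  locInt : ∀ Q : Set (Fin n → ℝ), IsCube Q → Q ⊆ Ω → IntegrableOn w Q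

/-- The Muckenhoupt `A₁(Ω)` class: `M_Ω w ≤ C w` a.e. on `Ω`. -/
def MemA1 {n : ℕ} (Ω : Set (Fin n → ℝ)) (w : (Fin n → ℝ) → ℝ) : Prop :=
  IsWeight Ω w ∧ ∃ C : ℝ, ∀ᵐ x ∂(volume.restrict Ω),
    maximal Ω w x ≤ ENNReal.ofReal (C * w x)

/-- The Muckenhoupt `A_p(Ω)` class for `1 < p < ∞`:
`sup_{Q ⊆ Ω} (avg_Q w) * (avg_Q w^(1-p'))^(p-1) < ∞` where `p' = p/(p-1)`. -/
def MemApGT1 {n : ℕ} (Ω : Set (Fin n → ℝ)) (p : ℝ) (w : (Fin n → ℝ) → ℝ) : Prop :=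
  IsWeight Ω w ∧ ∃ C : ℝ≥0∞, C ≠ ∞ ∧ ∀ Q : Set (Fin n → ℝ), IsCube Q → Q ⊆ Ω →
    ((volume Q)⁻¹ * ∫⁻ x in Q, ENNReal.ofReal (w x)) *
      ((volume Q)⁻¹ * ∫⁻ x in Q, ENNReal.ofReal (w x ^ (1 - p / (p - 1)))) ^ (p - 1) ≤ C

/-- The Muckenhoupt `A_p(Ω)` class for `1 ≤ p < ∞`. -/
def MemA {n : ℕ} (Ω : Set (Fin n → ℝ)) (p : ℝ) (w : (Fin n → ℝ) → ℝ) : Prop :=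
  (p = 1 ∧ MemA1 Ω w) ∨ (1 < p ∧ MemApGT1 Ω p w)

/-- The Muckenhoupt `A_∞(Ω)` class: the union of `A_p(Ω)` over `1 ≤ p < ∞`. -/
def MemAInf {n : ℕ} (Ω : Set (Fin n → ℝ)) (w : (Fin n → ℝ) → ℝ) : Prop :=
  ∃ p : ℝ, 1 ≤ p ∧ MemA Ω p w

/-- Membership in the weighted Lebesgue space `L^p_w(Ω)`: `f` measurable with
`∫_Ω |f|^p w < ∞`. -/
def MemLw {n : ℕ} (Ω : Set (Fin n → ℝ)) (p : ℝ) (w f : (Fin n → ℝ) → ℝ) : Prop :=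
  Measurable f ∧
    ∫⁻ x in Ω, ENNReal.ofReal |f x| ^ p * ENNReal.ofReal (w x) < ⊤

/-- Membership in the (unweighted) Lebesgue space `L^p(Ω)`. -/
def MemLeb {n : ℕ} (Ω : Set (Fin n → ℝ)) (p : ℝ) (f : (Fin n → ℝ) → ℝ) : Prop :=
  MemLw Ω p (fun _ => 1) f

/-- `f ∈ 𝓜_{A_p}(Ω)`: `f` is measurable and `|f| ≤ w` a.e. on `Ω` for some `w ∈ A_p(Ω)`. -/
def HasApMajorant {n : ℕ} (Ω : Set (Fin n → ℝ)) (p : ℝ) (f : (Fin n → ℝ) → ℝ) : Prop :=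
  Measurable f ∧ ∃ w, MemA Ω p w ∧ ∀ᵐ x ∂(volume.restrict Ω), |f x| ≤ w x

/-- `f ∈ 𝓜^r_{A_p}(Ω)`: `f` is measurable and `|f|^r ≤ w` a.e. on `Ω` for some
`w ∈ A_p(Ω)`. -/
def HasApPowMajorant {n : ℕ} (Ω : Set (Fin n → ℝ)) (p r : ℝ) (f : (Fin n → ℝ) → ℝ) : Prop :=
  Measurable f ∧ ∃ w, MemA Ω p w ∧ ∀ᵐ x ∂(volume.restrict Ω), |f x| ^ r ≤ w x

/-- `f ∈ 𝓜_{A_∞}(Ω)`: `f` is measurable and `|f| ≤ w` a.e. on `Ω` for some `w ∈ A_∞(Ω)`. -/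
def HasAInfMajorant {n : ℕ} (Ω : Set (Fin n → ℝ)) (f : (Fin n → ℝ) → ℝ) : Prop :=
  Measurable f ∧ ∃ w, MemAInf Ω w ∧ ∀ᵐ x ∂(volume.restrict Ω), |f x| ≤ w x

/-- Membership in weak `L^p(ℝⁿ)`: `sup_{t>0} t · |{|f| > t}|^{1/p} < ∞`. -/
def MemWeakLp {n : ℕ} (p : ℝ) (f : (Fin n → ℝ) → ℝ) : Prop :=
  Measurable f ∧ ∃ C : ℝ≥0∞, C ≠ ⊤ ∧ ∀ t : ℝ, 0 < t →
    ENNReal.ofReal t * volume {x | t < |f x|} ^ (1 / p) ≤ C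

theorem lintegral_mul_min_rpow_le {α : Type*} [MeasurableSpace α] {μ : Measure α}
    {σ : α → ℝ} (hσ : Measurable σ) (hσ0 : ∀ x, 0 ≤ σ x)
    {A c L : ℝ} (hA : 0 ≤ A) (hc : 0 < c) (hc1 : c ≤ 1) (hL : 0 ≤ L)
    (h : ∀ t, L ≤ t → ∫⁻ x in {x | t < σ x}, ENNReal.ofReal (σ x) ∂μ
      ≤ ENNReal.ofReal (A * t) * μ {x | c * t < σ x})
    {ε : ℝ} (hε : 0 < ε) (hε1 : ε ≤ 1) {N : ℝ} (hN : 0 ≤ N) :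
    ∫⁻ x, ENNReal.ofReal (σ x * min (σ x) N ^ ε) ∂μ ≤
      ENNReal.ofReal (L ^ ε) * ∫⁻ x, ENNReal.ofReal (σ x) ∂μ +
      ENNReal.ofReal (ε * A * (c⁻¹) ^ 2) *
        ∫⁻ x, ENNReal.ofReal (σ x * min (σ x) N ^ ε) ∂μ := by
  set ν := μ.withDensity fun x => ENNReal.ofReal (σ x) with hν
  have hm : Measurable fun x => min (σ x) N := hσ.min measurable_const
  have hm0 : ∀ x, 0 ≤ min (σ x) N := fun x => le_min (hσ0 x) hN
  have hσm : Measurable fun x => ENNReal.ofReal (σ x) := hσ.ennreal_ofReal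
  have e1 : ∫⁻ x, ENNReal.ofReal (σ x * min (σ x) N ^ ε) ∂μ =
      ∫⁻ x, ENNReal.ofReal (min (σ x) N ^ ε) ∂ν := by
    rw [hν, lintegral_withDensity_eq_lintegral_mul _ hσm (hm.pow_const ε).ennreal_ofReal]
    exact lintegral_congr fun x => by simp [ENNReal.ofReal_mul (hσ0 x)]
  have e2 : ∀ t ∈ Set.Ioi (0:ℝ), ν {x | t < min (σ x) N} * ENNReal.ofReal (t ^ (ε - 1)) ≤
      ν {_x | t < L} * ENNReal.ofReal (t ^ (ε - 1)) +
      ENNReal.ofReal A * (μ {x | t < c⁻¹ * min (σ x) N} *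
        ENNReal.ofReal (t ^ (1 + ε - 1))) := by
    intro t ht
    have ht : 0 < t := ht
    rcases lt_or_ge t L with h1 | h1
    · refine le_add_right (mul_le_mul_left (measure_mono fun x _ => h1) _)
    · refine le_add_left ?_
      rcases lt_or_ge t N with hN' | hN'
      · have k1 : ν {x | t < min (σ x) N} ≤
            ENNReal.ofReal (A * t) * μ {x | t < c⁻¹ * min (σ x) N} := by
          calc ν {x | t < min (σ x) N} ≤ ν {x | t < σ x} := by
                exact measure_mono fun x (hx : t < min (σ x) N) =>
                  show t < σ x from hx.trans_le (min_le_left _ _)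
            _ = _ := withDensity_apply _ (measurableSet_lt measurable_const hσ)
            _ ≤ _ := h t h1
            _ ≤ _ := by
                refine mul_le_mul_right (measure_mono fun x hx => ?_) _
                rw [Set.mem_ofPred_eq] at hx ⊢
                rw [← div_eq_inv_mul, lt_div_iff₀ hc, mul_comm]
                refine lt_min hx ?_
                nlinarith
        calc _ ≤ _ := mul_le_mul_left k1 _
          _ = _ := by
            rw [ENNReal.ofReal_mul hA, show t ^ (1 + ε - 1) = t * t ^ (ε - 1) by
              rw [← Real.rpow_one_add' ht.le (by linarith)]; ring_nf,
              ENNReal.ofReal_mul ht.le]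
            ring
      · have : {x | t < min (σ x) N} = ∅ := by
          ext x; simp only [Set.mem_ofPred_eq, Set.mem_empty_iff_false, iff_false, not_lt]
          exact (min_le_right _ _).trans hN'
        rw [this]; simp
  rw [e1, lintegral_rpow_eq_lintegral_meas_lt_mul ν (.of_forall hm0) hm.aemeasurable hε]
  have m1 : Measurable fun t : ℝ => ν {_x | t < L} * ENNReal.ofReal (t ^ (ε - 1)) := by
    refine Measurable.mul ?_ (by fun_prop)
    refine Antitone.measurable fun a b hab => measure_mono fun x hx => ?_
    exact hab.trans_lt hx
  calc _ ≤ ENNReal.ofReal ε * ∫⁻ t in Set.Ioi (0:ℝ), (_ + _) := by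
        gcongr 1
        exact setLIntegral_mono' measurableSet_Ioi e2
    _ = (ENNReal.ofReal ε * ∫⁻ t in Set.Ioi (0:ℝ),
          (ν {_x | t < L} * ENNReal.ofReal (t ^ (ε - 1)))) +
        ENNReal.ofReal ε * (ENNReal.ofReal A * ∫⁻ t in Set.Ioi (0:ℝ),
          μ {x | t < c⁻¹ * min (σ x) N} * ENNReal.ofReal (t ^ (1 + ε - 1))) := by
        rw [lintegral_add_left m1, lintegral_const_mul' _ _ ENNReal.ofReal_ne_top, mul_add]
    _ ≤ _ := by
      refine add_le_add ?_ ?_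
      · rw [← lintegral_rpow_eq_lintegral_meas_lt_mul ν (.of_forall fun _ => hL)
          aemeasurable_const hε, lintegral_const, hν, withDensity_apply _ .univ,
          Measure.restrict_univ]
      · have hm' : ∀ x, 0 ≤ c⁻¹ * min (σ x) N := fun x => mul_nonneg (by positivity) (hm0 x)
        have k := lintegral_rpow_eq_lintegral_meas_lt_mul μ (.of_forall hm')
          (hm.const_mul c⁻¹).aemeasurable (show 0 < 1 + ε by linarith)
        calc _ ≤ ENNReal.ofReal ε * (ENNReal.ofReal A * (ENNReal.ofReal (1 + ε) *
              ∫⁻ t in Set.Ioi (0:ℝ),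
              μ {x | t < c⁻¹ * min (σ x) N} * ENNReal.ofReal (t ^ (1 + ε - 1)))) := by
              gcongr
              exact le_mul_of_one_le_left zero_le (by simpa using hε.le)
          _ = ENNReal.ofReal (ε * A) * ∫⁻ x, ENNReal.ofReal ((c⁻¹ * min (σ x) N) ^ (1 + ε)) ∂μ := by
              rw [k, ENNReal.ofReal_mul hε.le, mul_assoc]
          _ ≤ ENNReal.ofReal (ε * A) * ∫⁻ x, ENNReal.ofReal (c⁻¹ ^ 2) *
                ENNReal.ofReal (σ x * min (σ x) N ^ ε) ∂μ := by
              gcongr with x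
              rw [← ENNReal.ofReal_mul (by positivity)]
              refine ENNReal.ofReal_le_ofReal ?_
              rw [Real.mul_rpow (by positivity) (hm0 x), Real.rpow_one_add' (hm0 x) (by linarith)]
              have : c⁻¹ ^ (1 + ε) ≤ c⁻¹ ^ 2 := by
                rw [← Real.rpow_two]
                exact Real.rpow_le_rpow_of_exponent_le ((one_le_inv₀ hc).2 hc1) (by linarith)
              have := min_le_left (σ x) N
              have := hm0 x
              have := hσ0 x
              gcongr
          _ = _ := by
              rw [lintegral_const_mul' _ _ ENNReal.ofReal_ne_top, e1,
                ← lintegral_rpow_eq_lintegral_meas_lt_mul ν (.of_forall hm0) hm.aemeasurable hε,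
                ENNReal.ofReal_mul (p := ε * A) (by positivity), mul_assoc]

/-- Higher integrability from a reverse weak-type estimate on the superlevel sets. -/
theorem exists_lintegral_rpow_lt_top {α : Type*} [MeasurableSpace α] {μ : Measure α}
    {σ : α → ℝ} (hσ : Measurable σ) (hσ0 : ∀ x, 0 ≤ σ x)
    (hint : ∫⁻ x, ENNReal.ofReal (σ x) ∂μ ≠ ∞)
    {A c L : ℝ} (hA : 0 ≤ A) (hc : 0 < c) (hc1 : c ≤ 1) (hL : 0 ≤ L)
    (h : ∀ t, L ≤ t → ∫⁻ x in {x | t < σ x}, ENNReal.ofReal (σ x) ∂μ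
      ≤ ENNReal.ofReal (A * t) * μ {x | c * t < σ x}) :
    ∃ ε : ℝ, 0 < ε ∧ ∫⁻ x, ENNReal.ofReal (σ x ^ (1 + ε)) ∂μ < ∞ := by
  set D := A * c⁻¹ ^ 2 with hD
  have hD0 : 0 ≤ D := by positivity
  obtain ⟨ε, hε, hε1, hεD⟩ : ∃ ε : ℝ, 0 < ε ∧ ε ≤ 1 ∧ ε * D ≤ 1 / 2 := by
    refine ⟨1 / (2 * (D + 1)), by positivity, ?_, ?_⟩
    · rw [div_le_one (by positivity)]; linarith
    · rw [div_mul_eq_mul_div, div_le_div_iff₀ (by positivity) (by positivity)]; linarith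
  refine ⟨ε, hε, ?_⟩
  set I := ∫⁻ x, ENNReal.ofReal (σ x) ∂μ
  have bound : ∀ N : ℕ, ∫⁻ x, ENNReal.ofReal (σ x * min (σ x) N ^ ε) ∂μ ≤
      2 * (ENNReal.ofReal (L ^ ε) * I) := by
    intro N
    set J := ∫⁻ x, ENNReal.ofReal (σ x * min (σ x) N ^ ε) ∂μ with hJ
    have hJfin : J ≠ ∞ := by
      refine ne_top_of_le_ne_top (ENNReal.mul_ne_top hint
        (ENNReal.ofReal_ne_top (r := (N : ℝ) ^ ε))) ?_
      rw [← lintegral_mul_const' _ _ ENNReal.ofReal_ne_top]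
      refine lintegral_mono fun x => ?_
      rw [← ENNReal.ofReal_mul (hσ0 x)]
      refine ENNReal.ofReal_le_ofReal (mul_le_mul_of_nonneg_left ?_ (hσ0 x))
      exact Real.rpow_le_rpow (le_min (hσ0 x) N.cast_nonneg) (min_le_right _ _) hε.le
    have key := lintegral_mul_min_rpow_le hσ hσ0 hA hc hc1 hL h hε hε1 (N := N) N.cast_nonneg
    have k2 : J ≤ ENNReal.ofReal (L ^ ε) * I + 2⁻¹ * J := by
      refine key.trans ?_
      gcongr
      rw [show (2⁻¹ : ℝ≥0∞) = ENNReal.ofReal (1 / 2) by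
        rw [one_div, ENNReal.ofReal_inv_of_pos two_pos]; simp]
      refine ENNReal.ofReal_le_ofReal ?_
      rw [mul_assoc]; exact hεD
    have k3 : 2⁻¹ * J + 2⁻¹ * J ≤ ENNReal.ofReal (L ^ ε) * I + 2⁻¹ * J := by
      rwa [← add_mul, ENNReal.inv_two_add_inv_two, one_mul]
    have k4 := (ENNReal.add_le_add_iff_right (ENNReal.mul_ne_top (by simp) hJfin)).1 k3
    calc J = 2 * (2⁻¹ * J) := by
          rw [← mul_assoc, ENNReal.mul_inv_cancel (by simp) (by simp), one_mul]
      _ ≤ _ := by gcongr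
  have hlim : ∫⁻ x, ENNReal.ofReal (σ x ^ (1 + ε)) ∂μ ≤ 2 * (ENNReal.ofReal (L ^ ε) * I) := by
    calc ∫⁻ x, ENNReal.ofReal (σ x ^ (1 + ε)) ∂μ
        = ∫⁻ x, ⨆ N : ℕ, ENNReal.ofReal (σ x * min (σ x) N ^ ε) ∂μ := by
          refine lintegral_congr fun x => le_antisymm ?_ (iSup_le fun N => ?_)
          · obtain ⟨N, hN⟩ := exists_nat_ge (σ x)
            refine le_iSup_of_le N ?_
            rw [min_eq_left hN, Real.rpow_one_add' (hσ0 x) (by linarith)]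
          · rw [Real.rpow_one_add' (hσ0 x) (by linarith)]
            refine ENNReal.ofReal_le_ofReal (mul_le_mul_of_nonneg_left ?_ (hσ0 x))
            exact Real.rpow_le_rpow (le_min (hσ0 x) N.cast_nonneg) (min_le_left _ _) hε.le
      _ = ⨆ N : ℕ, ∫⁻ x, ENNReal.ofReal (σ x * min (σ x) N ^ ε) ∂μ := by
          refine lintegral_iSup (fun N => ?_) fun N M hNM x => ?_
          · exact (hσ.mul ((hσ.min measurable_const).pow_const ε)).ennreal_ofReal
          · refine ENNReal.ofReal_le_ofReal (mul_le_mul_of_nonneg_left ?_ (hσ0 x))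
            refine Real.rpow_le_rpow (le_min (hσ0 x) N.cast_nonneg) ?_ hε.le
            gcongr
      _ ≤ _ := iSup_le bound
  exact hlim.trans_lt (ENNReal.mul_lt_top (by simp)
    (ENNReal.mul_lt_top ENNReal.ofReal_lt_top hint.lt_top))

/-- The uncentered maximal function over open sup-norm balls, that is, over open cubes. -/
noncomputable def ballMaximal {n : ℕ} (h : (Fin n → ℝ) → ℝ≥0∞) (y : Fin n → ℝ) : ℝ≥0∞ :=
  ⨆ (z : Fin n → ℝ) (τ : ℝ) (_ : 0 < τ) (_ : y ∈ Metric.ball z τ),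
    (volume (Metric.ball z τ))⁻¹ * ∫⁻ x in Metric.ball z τ, h x

theorem volume_ball_mul {n : ℕ} (z : Fin n → ℝ) {k τ : ℝ} (hk : 0 < k) (hτ : 0 < τ) :
    volume (Metric.ball z (k * τ)) = ENNReal.ofReal (k ^ n) * volume (Metric.ball z τ) := by
  rw [Real.volume_pi_ball z (mul_pos hk hτ), Real.volume_pi_ball z hτ,
    ← ENNReal.ofReal_mul (by positivity), Fintype.card_fin, ← mul_pow]
  ring_nf

theorem volume_closedBall_eq_volume_ball {n : ℕ} (z : Fin n → ℝ) {τ : ℝ} (hτ : 0 < τ) :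
    volume (Metric.closedBall z τ) = volume (Metric.ball z τ) := by
  rw [Real.volume_pi_ball z hτ, Real.volume_pi_closedBall z hτ.le]

theorem volume_ball_pos {n : ℕ} (z : Fin n → ℝ) {τ : ℝ} (hτ : 0 < τ) :
    volume (Metric.ball z τ) ≠ 0 := (Metric.measure_ball_pos volume z hτ).ne'

theorem volume_ball_finite {n : ℕ} (z : Fin n → ℝ) {τ : ℝ} :
    volume (Metric.ball z τ) ≠ ∞ := measure_ball_lt_top.ne

theorem lintegral_ball_le_mul_ballMaximal {n : ℕ} (h : (Fin n → ℝ) → ℝ≥0∞) {y z : Fin n → ℝ}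
    {τ : ℝ} (hτ : 0 < τ) (hy : y ∈ Metric.ball z τ) :
    ∫⁻ x in Metric.ball z τ, h x ≤ volume (Metric.ball z τ) * ballMaximal h y := by
  have : (volume (Metric.ball z τ))⁻¹ * ∫⁻ x in Metric.ball z τ, h x ≤ ballMaximal h y :=
    le_iSup_of_le z (le_iSup_of_le τ (le_iSup_of_le hτ (le_iSup_of_le hy le_rfl)))
  rwa [← ENNReal.div_eq_inv_mul, ENNReal.div_le_iff_le_mul (.inl (volume_ball_pos z hτ))
    (.inl (volume_ball_finite z)), mul_comm] at this

theorem ballMaximal_le {n : ℕ} {h : (Fin n → ℝ) → ℝ≥0∞} {y : Fin n → ℝ} {b : ℝ≥0∞}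
    (hb : ∀ (z : Fin n → ℝ) (τ : ℝ), 0 < τ → y ∈ Metric.ball z τ →
      ∫⁻ x in Metric.ball z τ, h x ≤ volume (Metric.ball z τ) * b) : ballMaximal h y ≤ b := by
  refine iSup_le fun z => iSup_le fun τ => iSup_le fun hτ => iSup_le fun hy => ?_
  rw [← ENNReal.div_eq_inv_mul, ENNReal.div_le_iff_le_mul (.inl (volume_ball_pos z hτ))
    (.inl (volume_ball_finite z)), mul_comm]
  exact hb z τ hτ hy

theorem lt_ballMaximal_iff {n : ℕ} {h : (Fin n → ℝ) → ℝ≥0∞} {y : Fin n → ℝ} {t : ℝ≥0∞} :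
    t < ballMaximal h y ↔ ∃ (z : Fin n → ℝ) (τ : ℝ), 0 < τ ∧ y ∈ Metric.ball z τ ∧
      t * volume (Metric.ball z τ) < ∫⁻ x in Metric.ball z τ, h x := by
  simp only [ballMaximal, lt_iSup_iff, exists_prop]
  refine exists_congr fun z => exists_congr fun τ => and_congr_right fun hτ =>
    and_congr_right fun _ => ?_
  rw [← ENNReal.div_eq_inv_mul, ENNReal.lt_div_iff_mul_lt (.inl (volume_ball_pos z hτ))
    (.inl (volume_ball_finite z))]

theorem isOpen_lt_ballMaximal {n : ℕ} (h : (Fin n → ℝ) → ℝ≥0∞) (t : ℝ≥0∞) :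
    IsOpen {y | t < ballMaximal h y} := by
  refine isOpen_iff_mem_nhds.2 fun y hy => ?_
  obtain ⟨z, τ, hτ, hyz, hlt⟩ := lt_ballMaximal_iff.1 hy
  filter_upwards [Metric.isOpen_ball.mem_nhds hyz] with y' hy'
  exact lt_ballMaximal_iff.2 ⟨z, τ, hτ, hy', hlt⟩

theorem measurable_ballMaximal {n : ℕ} (h : (Fin n → ℝ) → ℝ≥0∞) : Measurable (ballMaximal h) :=
  measurable_of_Ioi fun t => (isOpen_lt_ballMaximal h t).measurableSet

/-- The weak type `(1, 1)` estimate for the maximal function. -/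
theorem mul_volume_lt_ballMaximal_le {n : ℕ} (h : (Fin n → ℝ) → ℝ≥0∞) (t : ℝ≥0∞) :
    t * volume {y | t < ballMaximal h y} ≤ ENNReal.ofReal (5 ^ n) * ∫⁻ x, h x := by
  rw [(isOpen_lt_ballMaximal h t).measure_eq_iSup_isCompact, ENNReal.mul_iSup]
  refine iSup_le fun K => ?_
  rw [ENNReal.mul_iSup]
  refine iSup_le fun hKU => ?_
  rw [ENNReal.mul_iSup]
  refine iSup_le fun hK => ?_
  let T : Set ((Fin n → ℝ) × ℝ) := {p | 0 < p.2 ∧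
    t * volume (Metric.ball p.1 p.2) < ∫⁻ x in Metric.ball p.1 p.2, h x}
  obtain ⟨S, hST, hS, hKS⟩ := hK.elim_finite_subcover_image (b := T)
    (c := fun p => Metric.ball p.1 p.2) (fun _ _ => Metric.isOpen_ball) (fun y hy => by
      obtain ⟨z, τ, hτ, hyz, hlt⟩ := lt_ballMaximal_iff.1 (hKU hy)
      exact Set.mem_biUnion (x := (z, τ)) ⟨hτ, hlt⟩ hyz)
  obtain ⟨R, hR⟩ := (hS.image Prod.snd).bddAbove
  obtain ⟨u, huS, hdisj, hcov⟩ := Vitali.exists_disjoint_subfamily_covering_enlargement_closedBall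
    S Prod.fst Prod.snd R (fun a ha => hR (Set.mem_image_of_mem _ ha)) 5 (by norm_num)
  have hu : u.Countable := (hS.subset huS).countable
  have hKu : K ⊆ ⋃ p ∈ u, Metric.closedBall p.1 (5 * p.2) := by
    intro y hy
    obtain ⟨a, ha, hya⟩ := Set.mem_iUnion₂.1 (hKS hy)
    obtain ⟨b, hb, hab⟩ := hcov a ha
    exact Set.mem_biUnion hb (hab (Metric.ball_subset_closedBall hya))
  have hT : ∀ p ∈ u, 0 < p.2 ∧
    t * volume (Metric.ball p.1 p.2) < ∫⁻ x in Metric.ball p.1 p.2, h x :=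
    fun p hp => hST (huS hp)
  calc t * volume K ≤ t * ∑' p : u, volume (Metric.closedBall p.1.1 (5 * p.1.2)) := by
        gcongr
        exact (measure_mono hKu).trans (measure_biUnion_le _ hu _)
    _ = ∑' p : u, ENNReal.ofReal (5 ^ n) * (t * volume (Metric.ball p.1.1 p.1.2)) := by
        rw [← ENNReal.tsum_mul_left]
        refine tsum_congr fun p => ?_
        have h0 := (hT p p.2).1
        rw [volume_closedBall_eq_volume_ball _ (by positivity), volume_ball_mul _ (by norm_num) h0]
        ring
    _ ≤ ∑' p : u, ENNReal.ofReal (5 ^ n) * ∫⁻ x in Metric.ball p.1.1 p.1.2, h x := by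
        gcongr with p
        exact (hT p p.2).2.le
    _ = ENNReal.ofReal (5 ^ n) * ∫⁻ x in ⋃ p ∈ u, Metric.ball p.1 p.2, h x := by
        rw [ENNReal.tsum_mul_left, lintegral_biUnion hu (fun _ _ => measurableSet_ball)]
        exact hdisj.mono fun _ => Metric.ball_subset_closedBall
    _ ≤ _ := by
        gcongr
        exact Measure.restrict_le_self

theorem ae_ballMaximal_lt_top {n : ℕ} {h : (Fin n → ℝ) → ℝ≥0∞} (hint : ∫⁻ x, h x ≠ ∞) :
    ∀ᵐ y, ballMaximal h y < ∞ := by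
  have hfin : ENNReal.ofReal (5 ^ n) * ∫⁻ x, h x ≠ ∞ :=
    ENNReal.mul_ne_top ENNReal.ofReal_ne_top hint
  have : volume {y | ¬ ballMaximal h y < ∞} = 0 := by
    by_contra hne
    set m := volume {y | ¬ ballMaximal h y < ∞} with hm
    have hle : ∀ k : ℕ, (k : ℝ≥0∞) * m ≤ ENNReal.ofReal (5 ^ n) * ∫⁻ x, h x := fun k => by
      refine le_trans ?_ (mul_volume_lt_ballMaximal_le h k)
      gcongr
      refine measure_mono fun y (hy : ¬ ballMaximal h y < ∞) => ?_
      exact (ENNReal.natCast_lt_top k).trans_le (not_lt.1 hy)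
    obtain ⟨k, hk⟩ := ENNReal.exists_nat_mul_gt hne hfin
    exact absurd (hle k) (not_le.2 hk)
  exact this

theorem ae_le_ballMaximal {n : ℕ} {h : (Fin n → ℝ) → ℝ≥0∞} (hm : Measurable h)
    (hint : ∫⁻ x, h x ≠ ∞) : ∀ᵐ y, h y ≤ ballMaximal h y := by
  filter_upwards [(Besicovitch.vitaliFamily (volume : Measure (Fin n → ℝ))).ae_tendsto_lintegral_div'
    hm hint] with y hy
  refine le_of_tendsto (hy.comp (Besicovitch.tendsto_filterAt volume y)) ?_
  filter_upwards [self_mem_nhdsWithin] with τ (hτ : 0 < τ)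
  have hae : Metric.closedBall y τ =ᵐ[volume] Metric.ball y τ :=
    (ae_eq_of_subset_of_measure_ge Metric.ball_subset_closedBall
      (volume_closedBall_eq_volume_ball y hτ).le measurableSet_ball.nullMeasurableSet
      measure_closedBall_lt_top.ne).symm
  simp only [Function.comp]
  rw [setLIntegral_congr hae, measure_congr hae, ENNReal.div_eq_inv_mul]
  rw [← ENNReal.div_eq_inv_mul, ENNReal.div_le_iff_le_mul (.inl (volume_ball_pos y hτ))
    (.inl (volume_ball_finite y)), mul_comm]
  exact lintegral_ball_le_mul_ballMaximal h hτ (Metric.mem_ball_self hτ)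

/-- Kolmogorov's inequality: a weak-type bound gives integrability of powers below one. -/
theorem lintegral_rpow_le_of_weakType {α : Type*} [MeasurableSpace α] {μ : Measure α}
    {F : α → ℝ} (hF : Measurable F) (hF0 : ∀ x, 0 ≤ F x)
    {K U δ : ℝ} (hK : 0 ≤ K) (hU : 0 < U) (hδ : 0 < δ) (hδ1 : δ < 1)
    (h : ∀ t, 0 < t → ENNReal.ofReal t * μ {x | t < F x} ≤ ENNReal.ofReal (K * U) * μ Set.univ) :
    ∫⁻ x, ENNReal.ofReal (F x ^ δ) ∂μ ≤
      ENNReal.ofReal (U ^ δ * (1 + K * δ / (1 - δ))) * μ Set.univ := by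
  have h1δ : 0 < 1 - δ := by linarith
  rw [lintegral_rpow_eq_lintegral_meas_lt_mul μ (.of_forall hF0) hF.aemeasurable hδ]
  have hpt : ∀ t ∈ Set.Ioi (0:ℝ), μ {x | t < F x} * ENNReal.ofReal (t ^ (δ - 1)) ≤
      μ {_x | t < U} * ENNReal.ofReal (t ^ (δ - 1)) +
      (Set.Ici U).indicator (fun t : ℝ => ENNReal.ofReal (K * U) * μ Set.univ *
        ENNReal.ofReal (t ^ (δ - 2))) t := by
    intro t (ht : 0 < t)
    rcases lt_or_ge t U with h1 | h1
    · exact le_add_right (mul_le_mul_left (measure_mono fun x _ => h1) _)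
    · refine le_add_left ?_
      rw [Set.indicator_of_mem (show t ∈ Set.Ici U from h1),
        show t ^ (δ - 1) = t * t ^ (δ - 2) by
          rw [← Real.rpow_one_add' ht.le (by linarith)]; ring_nf,
        ENNReal.ofReal_mul ht.le, ← mul_assoc, mul_comm (μ _)]
      exact mul_le_mul_left (h t ht) _
  have m1 : Measurable fun t : ℝ => μ {_x | t < U} * ENNReal.ofReal (t ^ (δ - 1)) := by
    refine Measurable.mul ?_ (by fun_prop)
    refine Antitone.measurable fun a b hab => measure_mono fun x hx => ?_
    exact hab.trans_lt hx
  have e2 : ∫⁻ t in Set.Ioi (0:ℝ), (Set.Ici U).indicator (fun t : ℝ => ENNReal.ofReal (K * U) *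
      μ Set.univ * ENNReal.ofReal (t ^ (δ - 2))) t ≤
      ENNReal.ofReal (K * U) * μ Set.univ * ENNReal.ofReal (U ^ (δ - 1) / (1 - δ)) := by
    calc _ ≤ ∫⁻ t, (Set.Ici U).indicator (fun t : ℝ => ENNReal.ofReal (K * U) *
            μ Set.univ * ENNReal.ofReal (t ^ (δ - 2))) t := setLIntegral_le_lintegral _ _
      _ = _ := by
        rw [lintegral_indicator measurableSet_Ici, setLIntegral_congr Ioi_ae_eq_Ici.symm,
          lintegral_const_mul _ (by fun_prop),
          ← ofReal_integral_eq_lintegral_ofReal (integrableOn_Ioi_rpow_of_lt (by linarith) hU)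
            ((ae_restrict_iff' measurableSet_Ioi).2 (.of_forall fun t ht =>
              Real.rpow_nonneg (hU.trans ht).le _)),
          integral_Ioi_rpow_of_lt (by linarith) hU]
        congr 2
        rw [show δ - 2 + 1 = -(1 - δ) by ring, neg_div_neg_eq, neg_sub]
  calc _ ≤ ENNReal.ofReal δ * ∫⁻ t in Set.Ioi (0:ℝ), (_ + _) := by
        gcongr 1
        exact setLIntegral_mono' measurableSet_Ioi hpt
    _ ≤ ENNReal.ofReal (U ^ δ) * μ Set.univ + ENNReal.ofReal δ *
          (ENNReal.ofReal (K * U) * μ Set.univ * ENNReal.ofReal (U ^ (δ - 1) / (1 - δ))) := by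
        rw [lintegral_add_left m1, mul_add]
        refine add_le_add ?_ (mul_le_mul_right e2 _)
        rw [← lintegral_rpow_eq_lintegral_meas_lt_mul μ (.of_forall fun _ => hU.le)
          aemeasurable_const hδ, lintegral_const]
    _ = _ := by
        have : U ^ δ * (1 + K * δ / (1 - δ)) = U ^ δ + δ * (K * U) * (U ^ (δ - 1) / (1 - δ)) := by
          rw [show U ^ δ = U * U ^ (δ - 1) by
            rw [← Real.rpow_one_add' hU.le (by linarith)]; ring_nf]
          ring
        have hn : 0 ≤ U ^ (δ - 1) / (1 - δ) := by positivity
        rw [this, ENNReal.ofReal_add (by positivity) (by positivity), ENNReal.ofReal_mul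
          (p := δ * (K * U)) (by positivity), ENNReal.ofReal_mul hδ.le]
        ring

/-- The Coifman–Rochberg estimate: powers below one of a maximal function satisfy the `A₁`
condition. -/
theorem exists_lintegral_ballMaximal_rpow_le {n : ℕ} {h : (Fin n → ℝ) → ℝ≥0∞}
    {δ : ℝ} (hδ : 0 < δ) (hδ1 : δ < 1) :
    ∃ C : ℝ, 0 ≤ C ∧ ∀ (c : Fin n → ℝ) (ρ : ℝ), 0 < ρ → ∀ x ∈ Metric.closedBall c ρ,
      ballMaximal h x ≠ 0 → ballMaximal h x ≠ ∞ →
      ∫⁻ y in Metric.closedBall c ρ, ballMaximal h y ^ δ ≤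
        ENNReal.ofReal C * volume (Metric.closedBall c ρ) * ballMaximal h x ^ δ := by
  refine ⟨(1 + 15 ^ n * δ / (1 - δ)) + (3 ^ n) ^ δ, ?_, fun c ρ hρ x hx hx0 hxtop => ?_⟩
  · have : 0 < 1 - δ := by linarith
    positivity
  have h1δ : 0 < 1 - δ := by linarith
  set U := (ballMaximal h x).toReal with hUdef
  have hU : 0 < U := ENNReal.toReal_pos hx0 hxtop
  have hUe : ballMaximal h x = ENNReal.ofReal U := (ENNReal.ofReal_toReal hxtop).symm
  set h₁ := (Metric.ball c (3 * ρ)).indicator h with hh1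
  have hh1int : ∫⁻ y, h₁ y ≤ ENNReal.ofReal (3 ^ n * U) * volume (Metric.closedBall c ρ) := by
    rw [hh1, lintegral_indicator measurableSet_ball]
    have hx3 : x ∈ Metric.ball c (3 * ρ) :=
      Metric.closedBall_subset_ball (by linarith) hx
    refine (lintegral_ball_le_mul_ballMaximal h (by positivity) hx3).trans_eq ?_
    rw [volume_ball_mul _ (by norm_num) hρ, hUe, ENNReal.ofReal_mul (by positivity),
      volume_closedBall_eq_volume_ball _ hρ]
    ring
  have hh1fin : ∫⁻ y, h₁ y ≠ ∞ := ne_top_of_le_ne_top (ENNReal.mul_ne_top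
    ENNReal.ofReal_ne_top measure_closedBall_lt_top.ne) hh1int
  have hsplit : ∀ y ∈ Metric.closedBall c ρ,
      ballMaximal h y ≤ max (ballMaximal h₁ y) (ENNReal.ofReal (3 ^ n * U)) := by
    intro y hy
    refine ballMaximal_le fun z τ hτ hyz => ?_
    rw [Metric.mem_ball] at hyz
    rw [Metric.mem_closedBall] at hx hy
    rcases le_or_gt τ ρ with hle | hlt
    · refine le_trans ?_ (mul_le_mul_right (le_max_left _ _) _)
      refine le_trans (le_of_eq ?_) (lintegral_ball_le_mul_ballMaximal h₁ hτ hyz)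
      refine setLIntegral_congr_fun measurableSet_ball fun z' hz' => ?_
      rw [hh1, Set.indicator_of_mem]
      rw [Metric.mem_ball] at hz' ⊢
      have t1 := dist_triangle z' z c
      have t2 := dist_triangle z y c
      rw [dist_comm z y] at t2
      linarith
    · refine le_trans ?_ (mul_le_mul_right (le_max_right _ _) _)
      have hx3 : x ∈ Metric.ball z (3 * τ) := by
        rw [Metric.mem_ball]
        have t1 := dist_triangle x c z
        have t2 := dist_triangle c y z
        rw [dist_comm c y] at t2
        linarith
      have k := lintegral_ball_le_mul_ballMaximal h (by positivity) hx3
      rw [volume_ball_mul _ (by norm_num) hτ, hUe] at k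
      refine (lintegral_mono_set (Metric.ball_subset_ball (by linarith))).trans (k.trans_eq ?_)
      rw [ENNReal.ofReal_mul (by positivity)]
      ring
  set V := volume (Metric.closedBall c ρ) with hV
  have hkol := lintegral_rpow_le_of_weakType (μ := volume.restrict (Metric.closedBall c ρ))
    (F := fun y => (ballMaximal h₁ y).toReal) (measurable_ballMaximal h₁).ennreal_toReal
    (fun _ => ENNReal.toReal_nonneg) (K := 15 ^ n) (by positivity) hU hδ hδ1 (fun t ht => by
      rw [Measure.restrict_apply_univ]
      calc ENNReal.ofReal t * volume.restrict (Metric.closedBall c ρ)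
            {y | t < (ballMaximal h₁ y).toReal}
          ≤ ENNReal.ofReal t * volume {y | ENNReal.ofReal t < ballMaximal h₁ y} := by
            refine mul_le_mul_right ((Measure.restrict_apply_le _ _).trans
              (measure_mono fun y (hy : t < _) => ?_)) _
            exact (ENNReal.ofReal_lt_iff_lt_toReal ht.le fun htop => by
              simp [htop] at hy; linarith).2 hy
        _ ≤ _ := mul_volume_lt_ballMaximal_le h₁ _
        _ ≤ ENNReal.ofReal (5 ^ n) * (ENNReal.ofReal (3 ^ n * U) * V) := by gcongr
        _ = _ := by
          rw [← mul_assoc, ← ENNReal.ofReal_mul (by positivity), ← mul_assoc, ← mul_pow]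
          norm_num [hV])
  rw [Measure.restrict_apply_univ] at hkol
  calc ∫⁻ y in Metric.closedBall c ρ, ballMaximal h y ^ δ
      ≤ ∫⁻ y in Metric.closedBall c ρ, (ENNReal.ofReal ((ballMaximal h₁ y).toReal ^ δ) +
          ENNReal.ofReal ((3 ^ n * U) ^ δ)) := by
        refine lintegral_mono_ae ?_
        filter_upwards [ae_restrict_mem measurableSet_closedBall,
          ae_restrict_of_ae (ae_ballMaximal_lt_top hh1fin)] with y hy hfin
        rw [← ENNReal.ofReal_rpow_of_nonneg ENNReal.toReal_nonneg hδ.le,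
          ENNReal.ofReal_toReal hfin.ne, ← ENNReal.ofReal_rpow_of_nonneg (by positivity) hδ.le]
        refine (ENNReal.rpow_le_rpow (hsplit y hy) hδ.le).trans ?_
        rcases max_cases (ballMaximal h₁ y) (ENNReal.ofReal (3 ^ n * U)) with h' | h' <;> rw [h'.1]
        · exact le_self_add
        · exact le_add_self
    _ ≤ ENNReal.ofReal (U ^ δ * (1 + 15 ^ n * δ / (1 - δ))) * V +
          ENNReal.ofReal ((3 ^ n * U) ^ δ) * V := by
        rw [lintegral_add_right _ measurable_const, lintegral_const, Measure.restrict_apply_univ]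
        gcongr
    _ = _ := by
        rw [hUe, ENNReal.ofReal_rpow_of_nonneg hU.le hδ.le, Real.mul_rpow (by positivity) hU.le,
          ← add_mul, ← ENNReal.ofReal_add (by positivity) (by positivity), mul_right_comm,
          ← ENNReal.ofReal_mul (by positivity)]
        ring_nf

/-- The closed cube with lower corner `a` and side length `s`. -/
def cornerCube {n : ℕ} (a : Fin n → ℝ) (s : ℝ) : Set (Fin n → ℝ) :=
  Set.univ.pi fun i => Set.Icc (a i) (a i + s)

theorem mem_cornerCube {n : ℕ} {a : Fin n → ℝ} {s : ℝ} {x : Fin n → ℝ} :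
    x ∈ cornerCube a s ↔ ∀ i, a i ≤ x i ∧ x i ≤ a i + s := by
  simp only [cornerCube, Set.mem_univ_pi, Set.mem_Icc]

theorem cornerCube_eq_closedBall {n : ℕ} (a : Fin n → ℝ) {s : ℝ} (hs : 0 < s) :
    cornerCube a s = Metric.closedBall (fun i => a i + s / 2) (s / 2) := by
  rw [closedBall_pi _ (by positivity), cornerCube]
  congr 1
  ext i : 1
  rw [Real.closedBall_eq_Icc]
  congr 1 <;> ring

theorem closedBall_eq_cornerCube {n : ℕ} (x : Fin n → ℝ) {τ : ℝ} (hτ : 0 < τ) :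
    Metric.closedBall x τ = cornerCube (fun i => x i - τ) (2 * τ) := by
  rw [cornerCube_eq_closedBall _ (by positivity)]
  congr 1
  · ext i; ring
  · ring

theorem volume_cornerCube {n : ℕ} (a : Fin n → ℝ) (s : ℝ) :
    volume (cornerCube a s) = ENNReal.ofReal s ^ n := by
  rw [cornerCube, volume_pi_pi]
  simp

theorem volume_cornerCube_ne_zero {n : ℕ} (a : Fin n → ℝ) {s : ℝ} (hs : 0 < s) :
    volume (cornerCube a s) ≠ 0 := by
  rw [volume_cornerCube]
  exact pow_ne_zero _ (by simpa using hs)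

theorem volume_cornerCube_ne_top {n : ℕ} (a : Fin n → ℝ) (s : ℝ) :
    volume (cornerCube a s) ≠ ∞ := by
  rw [volume_cornerCube]
  exact ENNReal.pow_ne_top ENNReal.ofReal_ne_top

theorem measurableSet_cornerCube {n : ℕ} (a : Fin n → ℝ) (s : ℝ) :
    MeasurableSet (cornerCube a s) :=
  MeasurableSet.univ_pi fun _ => measurableSet_Icc

/-- The pair `p` of a lower corner and a side length encodes a subcube of `cornerCube a l`. -/
def IsSubcube {n : ℕ} (a : Fin n → ℝ) (l : ℝ) (p : (Fin n → ℝ) × ℝ) : Prop :=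
  0 < p.2 ∧ p.2 ≤ l ∧ ∀ i, a i ≤ p.1 i ∧ p.1 i + p.2 ≤ a i + l

theorem IsSubcube.subset {n : ℕ} {a : Fin n → ℝ} {l : ℝ} {p : (Fin n → ℝ) × ℝ}
    (hp : IsSubcube a l p) : cornerCube p.1 p.2 ⊆ cornerCube a l := fun x hx => by
  rw [mem_cornerCube] at hx ⊢
  exact fun i => ⟨(hp.2.2 i).1.trans (hx i).1, (hx i).2.trans (hp.2.2 i).2⟩

/-- A subcube can be enlarged by a factor of five (or to the full cube) so as to swallow all
subcubes of at most twice its size that meet it. -/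
theorem IsSubcube.exists_enlargement {n : ℕ} {a : Fin n → ℝ} {l : ℝ} {p : (Fin n → ℝ) × ℝ}
    (hp : IsSubcube a l p) :
    ∃ d : Fin n → ℝ, IsSubcube a l (d, min (5 * p.2) l) ∧
      cornerCube p.1 p.2 ⊆ cornerCube d (min (5 * p.2) l) ∧
      ∀ p' : (Fin n → ℝ) × ℝ, IsSubcube a l p' → p'.2 ≤ 2 * p.2 →
        (cornerCube p'.1 p'.2 ∩ cornerCube p.1 p.2).Nonempty →
        cornerCube p'.1 p'.2 ⊆ cornerCube d (min (5 * p.2) l) := by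
  obtain ⟨b, s⟩ := p
  obtain ⟨hs, hsl, hb⟩ := hp
  dsimp only at hs hsl hb ⊢
  set m := min (5 * s) l with hm
  have hml : m ≤ l := min_le_right _ _
  have hm0 : 0 < m := lt_min (by linarith) (by linarith)
  have key : ∀ i x, a i ≤ x → x ≤ a i + l → b i - 2 * s ≤ x → x ≤ b i + 3 * s →
      max (a i) (min (b i - 2 * s) (a i + l - m)) ≤ x ∧
      x ≤ max (a i) (min (b i - 2 * s) (a i + l - m)) + m := by
    intro i x h1 h2 h3 h4
    have := hb i
    rcases min_cases (5 * s) l with h | h <;>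
    rcases max_cases (a i) (min (b i - 2 * s) (a i + l - m)) with h' | h' <;>
    rcases min_cases (b i - 2 * s) (a i + l - m) with h'' | h'' <;>
    constructor <;> linarith
  refine ⟨fun i => max (a i) (min (b i - 2 * s) (a i + l - m)), ⟨hm0, hml, fun i =>
    ⟨le_max_left _ _, ?_⟩⟩, fun x hx => ?_, fun p' hp' hs' hne x hx => ?_⟩
  · rcases max_cases (a i) (min (b i - 2 * s) (a i + l - m)) with h' | h' <;>
    rcases min_cases (b i - 2 * s) (a i + l - m) with h'' | h'' <;> dsimp only <;> linarith
  · rw [mem_cornerCube] at hx ⊢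
    intro i
    have h1 := hx i
    have h2 := hb i
    exact key i _ (by linarith) (by linarith) (by linarith) (by linarith)
  · obtain ⟨y, hy', hy⟩ := hne
    rw [mem_cornerCube] at hx hy hy' ⊢
    intro i
    have h1 := hx i
    have h2 := hb i
    have h3 := hy i
    have h4 := hy' i
    have h5 := hp'.2.2 i
    exact key i _ (by linarith) (by linarith) (by linarith) (by linarith)

/-- Almost every point of a superlevel set lies in a subcube with a large average. -/
theorem ae_exists_isSubcube_lt {n : ℕ} {a : Fin n → ℝ} {l : ℝ} (hl : 0 < l)
    {f : (Fin n → ℝ) → ℝ≥0∞} (hf : Measurable f) (hint : ∫⁻ x in cornerCube a l, f x ≠ ∞)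
    (t : ℝ≥0∞) :
    ∀ᵐ x, x ∈ cornerCube a l → t < f x → ∃ p, IsSubcube a l p ∧ x ∈ cornerCube p.1 p.2 ∧
      t * volume (cornerCube p.1 p.2) < ∫⁻ y in cornerCube p.1 p.2, f y := by
  have hint' : ∫⁻ x, (cornerCube a l).indicator f x ≠ ∞ := by
    rwa [lintegral_indicator (measurableSet_cornerCube a l)]
  have hinterior : (Set.univ.pi fun i => Set.Ioo (a i) (a i + l)) =ᵐ[volume] cornerCube a l := by
    have : cornerCube a l = Set.Icc a (fun i => a i + l) := by
      rw [cornerCube, Set.pi_univ_Icc]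
    rw [this]
    exact Measure.univ_pi_Ioo_ae_eq_Icc
  filter_upwards [(Besicovitch.vitaliFamily (volume : Measure (Fin n → ℝ))).ae_tendsto_lintegral_div'
    (hf.indicator (measurableSet_cornerCube a l)) hint', hinterior.mem_iff] with x hx hmem hxQ ht
  have hxo := hmem.2 hxQ
  rw [Set.indicator_of_mem hxQ] at hx
  have h1 := (hx.comp (Besicovitch.tendsto_filterAt volume x)).eventually (lt_mem_nhds ht)
  have hsmall : ∀ e : ℝ, 0 < e → ∀ᶠ τ : ℝ in nhdsWithin 0 (Set.Ioi 0), τ < e := fun e he =>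
    (gt_mem_nhds he).filter_mono nhdsWithin_le_nhds
  have h2 : ∀ᶠ τ : ℝ in nhdsWithin 0 (Set.Ioi 0), ∀ i, τ < x i - a i ∧ τ < a i + l - x i := by
    refine Filter.eventually_all.2 fun i => ?_
    have := hxo i (Set.mem_univ i)
    exact (hsmall _ (by linarith [this.1])).and (hsmall _ (by linarith [this.2]))
  obtain ⟨τ, ⟨hlt, hτi, hτl⟩, hτ⟩ := ((h1.and (h2.and (hsmall (l / 2) (by positivity)))).and
    self_mem_nhdsWithin).exists
  have hτ : 0 < τ := hτ
  have hsub : IsSubcube a l ((fun i => x i - τ), 2 * τ) :=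
    ⟨by positivity, by dsimp only; linarith, fun i => by
      have := hτi i
      constructor <;> dsimp only <;> linarith⟩
  refine ⟨_, hsub, mem_cornerCube.2 fun i => by constructor <;> dsimp only <;> linarith, ?_⟩
  simp only [Function.comp] at hlt
  rw [closedBall_eq_cornerCube x hτ, ENNReal.lt_div_iff_mul_lt
    (.inl (volume_cornerCube_ne_zero _ (by positivity))) (.inl (volume_cornerCube_ne_top _ _)),
    setLIntegral_congr_fun (measurableSet_cornerCube _ _) (g := f) fun y hy =>
      Set.indicator_of_mem (hsub.subset hy) f] at hlt
  exact hlt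

/-- A Calderón–Zygmund type estimate: if every subcube has a large portion on which `σ` exceeds a
multiple of its average, then `σ` satisfies a reverse weak-type estimate. -/
theorem lintegral_superlevel_le {n : ℕ} {a : Fin n → ℝ} {l : ℝ} (hl : 0 < l)
    {σ : (Fin n → ℝ) → ℝ≥0∞} (hσ : Measurable σ) (hint : ∫⁻ x in cornerCube a l, σ x ≠ ∞)
    {c : ℝ≥0∞}
    (hhalf : ∀ p, IsSubcube a l p → volume (cornerCube p.1 p.2) ≤ 2 *
      volume {y ∈ cornerCube p.1 p.2 |
        c * ∫⁻ x in cornerCube p.1 p.2, σ x < σ y * volume (cornerCube p.1 p.2)})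
    {t : ℝ≥0∞} (ht : ∫⁻ x in cornerCube a l, σ x ≤ t * volume (cornerCube a l)) :
    ∫⁻ x in cornerCube a l ∩ {x | t < σ x}, σ x ≤
      2 * 5 ^ n * t * volume (cornerCube a l ∩ {x | c * t < σ x}) := by
  let T : Set ((Fin n → ℝ) × ℝ) := {p | IsSubcube a l p ∧
    t * volume (cornerCube p.1 p.2) < ∫⁻ y in cornerCube p.1 p.2, σ y ∧
    ∀ p', IsSubcube a l p' → cornerCube p.1 p.2 ⊆ cornerCube p'.1 p'.2 → 2 * p.2 ≤ p'.2 →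
      ∫⁻ y in cornerCube p'.1 p'.2, σ y ≤ t * volume (cornerCube p'.1 p'.2)}
  have hcover : ∀ p, IsSubcube a l p →
      t * volume (cornerCube p.1 p.2) < ∫⁻ y in cornerCube p.1 p.2, σ y →
      ∃ p' ∈ T, cornerCube p.1 p.2 ⊆ cornerCube p'.1 p'.2 := by
    intro p hp hlt
    let S : Set ℝ := {s | ∃ b, IsSubcube a l (b, s) ∧ cornerCube p.1 p.2 ⊆ cornerCube b s ∧
      t * volume (cornerCube b s) < ∫⁻ y in cornerCube b s, σ y}
    have hpS : p.2 ∈ S := ⟨p.1, hp, subset_rfl, hlt⟩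
    have hbdd : BddAbove S := ⟨l, fun s ⟨_, hb, _⟩ => hb.2.1⟩
    have hpos : 0 < sSup S := hp.1.trans_le (le_csSup hbdd hpS)
    obtain ⟨s, ⟨b, hb, hpb, hbt⟩, hs⟩ := exists_lt_of_lt_csSup ⟨_, hpS⟩ (half_lt_self hpos)
    refine ⟨(b, s), ⟨hb, hbt, fun p' hp' hsub hle => ?_⟩, hpb⟩
    by_contra hcon
    have : p'.2 ≤ sSup S := le_csSup hbdd ⟨p'.1, hp', hpb.trans hsub, not_le.1 hcon⟩
    dsimp only at hle
    linarith
  obtain ⟨u, huT, hdisj, hu⟩ := Vitali.exists_disjoint_subfamily_covering_enlargement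
    (fun p : (Fin n → ℝ) × ℝ => cornerCube p.1 p.2) T Prod.snd 2 one_lt_two
    (fun p hp => hp.1.1.le) l (fun p hp => hp.1.2.1)
    (fun p hp => ⟨p.1, mem_cornerCube.2 fun i => ⟨le_rfl, by linarith [hp.1.1]⟩⟩)
  have hcount : u.Countable := hdisj.countable_of_nonempty_interior fun p hp => by
    have h0 := (huT hp).1.1
    rw [cornerCube_eq_closedBall _ h0]
    exact ⟨_, Metric.ball_subset_interior_closedBall (Metric.mem_ball_self (by positivity))⟩
  choose! d hdsub hpd hd using fun p (hp : p ∈ u) => (huT hp).1.exists_enlargement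
  set ν := volume.withDensity σ with hν
  have hνapp : ∀ b s, ν (cornerCube b s) = ∫⁻ y in cornerCube b s, σ y :=
    fun b s => withDensity_apply _ (measurableSet_cornerCube b s)
  have hνd : ∀ p ∈ u, ν (cornerCube (d p) (min (5 * p.2) l)) ≤
      5 ^ n * t * volume (cornerCube p.1 p.2) := by
    intro p hp
    have h0 := (huT hp).1.1
    have hle : ν (cornerCube (d p) (min (5 * p.2) l)) ≤
        t * volume (cornerCube (d p) (min (5 * p.2) l)) := by
      rw [hνapp]
      rcases le_total (5 * p.2) l with h5 | h5
      · have h1 := hdsub p hp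
        have h2 := hpd p hp
        rw [min_eq_left h5] at h1 h2 ⊢
        exact (huT hp).2.2 _ h1 h2 (by dsimp only; linarith)
      · rw [min_eq_right h5]
        have h1 := (hdsub p hp).2.2
        have : d p = a := by
          ext i
          have h2 := h1 i
          dsimp only at h2
          rw [min_eq_right h5] at h2
          linarith [h2.1, h2.2]
        rw [this]
        exact ht
    refine hle.trans ?_
    rw [volume_cornerCube, volume_cornerCube, mul_comm _ t, mul_assoc]
    gcongr
    rw [← mul_pow]
    gcongr
    calc ENNReal.ofReal (min (5 * p.2) l) ≤ ENNReal.ofReal (5 * p.2) :=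
          ENNReal.ofReal_le_ofReal (min_le_left _ _)
      _ = _ := by rw [ENNReal.ofReal_mul (by norm_num)]; norm_num
  have hgood : ∀ p ∈ u, volume (cornerCube p.1 p.2) ≤
      2 * volume (cornerCube p.1 p.2 ∩ {x | c * t < σ x}) := by
    intro p hp
    obtain ⟨hps, hpt, -⟩ := huT hp
    refine (hhalf p hps).trans ?_
    have hsub : {y ∈ cornerCube p.1 p.2 | c * ∫⁻ x in cornerCube p.1 p.2, σ x <
        σ y * volume (cornerCube p.1 p.2)} ⊆ cornerCube p.1 p.2 ∩ {x | c * t < σ x} := by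
      rintro y ⟨hy1, hy2⟩
      refine ⟨hy1, ?_⟩
      have h1 : c * t * volume (cornerCube p.1 p.2) < σ y * volume (cornerCube p.1 p.2) := by
        rw [mul_assoc]
        exact (mul_le_mul_right hpt.le c).trans_lt hy2
      exact lt_of_mul_lt_mul_right' h1
    exact mul_le_mul_right (measure_mono hsub) _
  have hae : (cornerCube a l ∩ {x | t < σ x} : Set _) ≤ᵐ[ν]
      (⋃ p ∈ u, cornerCube (d p) (min (5 * p.2) l) : Set _) := by
    have hac : ν ≪ volume := withDensity_absolutelyContinuous _ _
    refine Filter.Eventually.filter_mono hac.ae_le ?_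
    filter_upwards [ae_exists_isSubcube_lt hl hσ hint t] with x hx hmem
    obtain ⟨p, hp, hxp, hpt⟩ := hx hmem.1 hmem.2
    obtain ⟨p', hp', hsub⟩ := hcover p hp hpt
    obtain ⟨b, hb, hne, hle⟩ := hu p' hp'
    exact Set.mem_biUnion hb (hd b hb p' hp'.1 hle hne (hsub hxp))
  have hmeas : MeasurableSet {x | c * t < σ x} := measurableSet_lt measurable_const hσ
  calc ∫⁻ x in cornerCube a l ∩ {x | t < σ x}, σ x
      = ν (cornerCube a l ∩ {x | t < σ x}) := (withDensity_apply _
        ((measurableSet_cornerCube a l).inter (measurableSet_lt measurable_const hσ))).symm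
    _ ≤ ν (⋃ p ∈ u, cornerCube (d p) (min (5 * p.2) l)) := measure_mono_ae hae
    _ ≤ ∑' p : u, ν (cornerCube (d p) (min (5 * p.1.2) l)) := measure_biUnion_le _ hcount _
    _ ≤ ∑' p : u, 2 * 5 ^ n * t * volume (cornerCube p.1.1 p.1.2 ∩ {x | c * t < σ x}) := by
        refine ENNReal.tsum_le_tsum fun p => (hνd p p.2).trans ?_
        refine (mul_le_mul_right (hgood p p.2) _).trans_eq ?_
        ring
    _ = 2 * 5 ^ n * t * volume (⋃ p ∈ u, cornerCube p.1 p.2 ∩ {x | c * t < σ x}) := by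
        rw [ENNReal.tsum_mul_left, measure_biUnion hcount
          (hdisj.mono fun _ => Set.inter_subset_left)
          fun p _ => (measurableSet_cornerCube _ _).inter hmeas]
    _ ≤ _ := by
        gcongr
        exact Set.iUnion₂_subset fun p hp =>
          Set.inter_subset_inter_left _ (huT hp).1.subset

/-- Under an `A_q` bound on the averages of `v` and of its dual weight `σ`, the set where `σ` is
at least a fixed fraction of its average occupies at least half of the space. -/
theorem measure_univ_le_two_mul_measure_lt {α : Type*} [MeasurableSpace α] {μ : Measure α}
    [IsFiniteMeasure μ] (hμ : μ Set.univ ≠ 0) {v σ : α → ℝ≥0∞} (hvm : Measurable v)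
    (hσ : Measurable σ)
    {s : ℝ} (hs : 0 < s) (hv : ∀ᵐ x ∂μ, 1 ≤ v x * σ x ^ s) {c C : ℝ≥0∞}
    (hC : ((μ Set.univ)⁻¹ * ∫⁻ x, v x ∂μ) * ((μ Set.univ)⁻¹ * ∫⁻ x, σ x ∂μ) ^ s ≤ C)
    (hc : c ^ s * C ≤ 2⁻¹) :
    μ Set.univ ≤ 2 * μ {x | c * ∫⁻ x, σ x ∂μ < σ x * μ Set.univ} := by
  set V := μ Set.univ with hV
  set I := ∫⁻ x, σ x ∂μ with hI
  have hVtop : V ≠ ∞ := measure_ne_top _ _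
  have hm : MeasurableSet {x | c * I < σ x * V} :=
    measurableSet_lt measurable_const (hσ.mul_const _)
  have hE : μ {x | c * I < σ x * V}ᶜ ≤ 2⁻¹ * V :=
    calc μ {x | c * I < σ x * V}ᶜ = ∫⁻ _ in {x | c * I < σ x * V}ᶜ, 1 ∂μ := by simp
      _ ≤ ∫⁻ x in {x | c * I < σ x * V}ᶜ, (c * (V⁻¹ * I)) ^ s * v x ∂μ := by
          refine lintegral_mono_ae ?_
          filter_upwards [ae_restrict_of_ae hv, ae_restrict_mem hm.compl] with x hx hxE
          refine hx.trans ?_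
          rw [mul_comm]
          have h1 : σ x * V ≤ c * I := not_lt.1 hxE
          have h2 : σ x ≤ c * (V⁻¹ * I) := by
            rw [mul_left_comm, mul_comm, ← div_eq_mul_inv]
            exact (ENNReal.le_div_iff_mul_le (Or.inl hμ) (Or.inl hVtop)).2 h1
          gcongr
      _ ≤ ∫⁻ x, (c * (V⁻¹ * I)) ^ s * v x ∂μ := setLIntegral_le_lintegral _ _
      _ = (c * (V⁻¹ * I)) ^ s * ∫⁻ x, v x ∂μ := lintegral_const_mul _ hvm
      _ = c ^ s * ((V⁻¹ * ∫⁻ x, v x ∂μ) * (V⁻¹ * I) ^ s) * V := by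
          rw [ENNReal.mul_rpow_of_nonneg _ _ hs.le]
          calc c ^ s * (V⁻¹ * I) ^ s * ∫⁻ x, v x ∂μ
              = c ^ s * (V⁻¹ * I) ^ s * (∫⁻ x, v x ∂μ) * (V⁻¹ * V) := by
                rw [ENNReal.inv_mul_cancel hμ hVtop, mul_one]
            _ = _ := by ring
      _ ≤ 2⁻¹ * V := mul_le_mul_left ((mul_le_mul_right hC _).trans hc) _
  have hsplit : V ≤ μ {x | c * I < σ x * V} + 2⁻¹ * V :=
    (measure_add_measure_compl hm).symm.le.trans (by gcongr)
  have hhalf : 2⁻¹ * V + 2⁻¹ * V = V := by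
    rw [← add_mul, ENNReal.inv_two_add_inv_two, one_mul]
  have h2 : 2⁻¹ * V ≤ μ {x | c * I < σ x * V} := by
    refine (ENNReal.add_le_add_iff_right
      (ENNReal.mul_ne_top (by simp) hVtop : 2⁻¹ * V ≠ ∞)).1 ?_
    rwa [hhalf]
  calc V = 2 * (2⁻¹ * V) := by rw [two_mul, hhalf]
    _ ≤ _ := mul_le_mul_right h2 _

theorem isCube_cornerCube {n : ℕ} (a : Fin n → ℝ) {s : ℝ} (hs : 0 < s) : IsCube (cornerCube a s) :=
  ⟨a, s, hs, rfl⟩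

theorem IsCube.exists_eq_cornerCube {n : ℕ} {Q : Set (Fin n → ℝ)} (hQ : IsCube Q) :
    ∃ (a : Fin n → ℝ) (l : ℝ), 0 < l ∧ Q = cornerCube a l :=
  hQ

theorem IsCube.measurableSet {n : ℕ} {Q : Set (Fin n → ℝ)} (hQ : IsCube Q) : MeasurableSet Q := by
  obtain ⟨a, l, -, rfl⟩ := hQ.exists_eq_cornerCube
  exact measurableSet_cornerCube a l

theorem IsCube.volume_ne_zero {n : ℕ} {Q : Set (Fin n → ℝ)} (hQ : IsCube Q) : volume Q ≠ 0 := by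
  obtain ⟨a, l, hl, rfl⟩ := hQ.exists_eq_cornerCube
  exact volume_cornerCube_ne_zero a hl

theorem IsCube.volume_ne_top {n : ℕ} {Q : Set (Fin n → ℝ)} (hQ : IsCube Q) : volume Q ≠ ∞ := by
  obtain ⟨a, l, -, rfl⟩ := hQ.exists_eq_cornerCube
  exact volume_cornerCube_ne_top a l

/-- A weight has positive integral over every cube of its domain. -/
theorem IsWeight.lintegral_ne_zero {n : ℕ} {Ω Q : Set (Fin n → ℝ)} {w : (Fin n → ℝ) → ℝ}
    (hw : IsWeight Ω w) (hQ : IsCube Q) (hQΩ : Q ⊆ Ω) : ∫⁻ x in Q, ENNReal.ofReal (w x) ≠ 0 := by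
  intro h0
  rw [lintegral_eq_zero_iff hw.measurable.ennreal_ofReal] at h0
  have h2 : ∀ᵐ _ ∂volume.restrict Q, False := by
    filter_upwards [h0, ae_restrict_of_ae_restrict_of_subset hQΩ hw.pos] with x hx hx'
    exact (ENNReal.ofReal_pos.2 hx').ne' hx
  rw [Filter.eventually_false_iff_eq_bot, ae_eq_bot, Measure.restrict_eq_zero] at h2
  exact hQ.volume_ne_zero h2

/-- The dual weight of an `A_q` weight on a cube is integrable to some power above one. -/
theorem MemApGT1.exists_lintegral_dual_rpow_lt_top {n : ℕ} {a : Fin n → ℝ} {l : ℝ} (hl : 0 < l)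
    {q : ℝ} (hq : 1 < q) {w : (Fin n → ℝ) → ℝ} (hw : MemApGT1 (cornerCube a l) q w) :
    ∃ ε : ℝ, 0 < ε ∧
      ∫⁻ x in cornerCube a l, ENNReal.ofReal (max (w x ^ (1 - q / (q - 1))) 0 ^ (1 + ε)) < ∞ := by
  obtain ⟨hwt, C, hCtop, hC⟩ := hw
  have hs : 0 < q - 1 := by linarith
  set σ : (Fin n → ℝ) → ℝ := fun x => max (w x ^ (1 - q / (q - 1))) 0 with hσdef
  have hσm : Measurable σ := (hwt.measurable.pow_const _).max measurable_const
  have hσ0 : ∀ x, 0 ≤ σ x := fun x => le_max_right _ _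
  have hσe : ∀ x, ENNReal.ofReal (w x ^ (1 - q / (q - 1))) = ENNReal.ofReal (σ x) := fun x => by
    simp [σ, ENNReal.ofReal_max]
  simp only [hσe] at hC
  have hK0 := volume_cornerCube_ne_zero a hl
  have hKtop := volume_cornerCube_ne_top a l
  have hone : ∀ᵐ x ∂volume.restrict (cornerCube a l),
      1 ≤ ENNReal.ofReal (w x) * ENNReal.ofReal (σ x) ^ (q - 1) := by
    filter_upwards [hwt.pos] with x hx
    have h1 : w x * σ x ^ (q - 1) = 1 := by
      have h2 : σ x = w x ^ (1 - q / (q - 1)) := max_eq_left (by positivity)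
      rw [h2, ← Real.rpow_mul hx.le]
      nth_rewrite 1 [← Real.rpow_one (w x)]
      rw [← Real.rpow_add hx]
      convert Real.rpow_zero _ using 2
      field_simp
      ring
    rw [ENNReal.ofReal_rpow_of_nonneg (hσ0 x) hs.le, ← ENNReal.ofReal_mul hx.le, h1]
    simp
  have hint : ∫⁻ x in cornerCube a l, ENNReal.ofReal (σ x) ≠ ∞ := by
    intro htop
    have h1 := hC _ (isCube_cornerCube a hl) subset_rfl
    rw [htop, ENNReal.mul_top (ENNReal.inv_ne_zero.2 hKtop), ENNReal.top_rpow_of_pos hs] at h1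
    refine hCtop (top_le_iff.1 ((ENNReal.mul_top ?_).symm.le.trans h1))
    exact mul_ne_zero (ENNReal.inv_ne_zero.2 hKtop)
      (hwt.lintegral_ne_zero (isCube_cornerCube a hl) subset_rfl)
  set c : ℝ := (2 * (C.toReal + 1))⁻¹ ^ (q - 1)⁻¹ with hc
  have hCpos : 0 < 2 * (C.toReal + 1) := by positivity
  have hc0 : 0 < c := by positivity
  have hc1 : c ≤ 1 := Real.rpow_le_one (by positivity)
    (inv_le_one_of_one_le₀ (by linarith [C.toReal_nonneg])) (by positivity)
  have hcC : ENNReal.ofReal c ^ (q - 1) * C ≤ 2⁻¹ := by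
    rw [ENNReal.ofReal_rpow_of_pos hc0, hc, Real.rpow_inv_rpow (by positivity) hs.ne',
      ← ENNReal.ofReal_toReal hCtop, ← ENNReal.ofReal_mul (by positivity),
      ENNReal.toReal_ofReal C.toReal_nonneg]
    calc _ ≤ ENNReal.ofReal 2⁻¹ := by
          refine ENNReal.ofReal_le_ofReal ?_
          rw [inv_mul_le_iff₀ hCpos]
          linarith
      _ = 2⁻¹ := by rw [ENNReal.ofReal_inv_of_pos two_pos]; simp
  have hhalf : ∀ p, IsSubcube a l p → volume (cornerCube p.1 p.2) ≤ 2 *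
      volume {y ∈ cornerCube p.1 p.2 | ENNReal.ofReal c *
        ∫⁻ x in cornerCube p.1 p.2, ENNReal.ofReal (σ x) <
          ENNReal.ofReal (σ y) * volume (cornerCube p.1 p.2)} := by
    intro p hp
    have : IsFiniteMeasure (volume.restrict (cornerCube p.1 p.2)) :=
      ⟨by simpa using (volume_cornerCube_ne_top p.1 p.2).lt_top⟩
    have h1 := measure_univ_le_two_mul_measure_lt (μ := volume.restrict (cornerCube p.1 p.2))
      (by simpa using volume_cornerCube_ne_zero p.1 hp.1) hwt.measurable.ennreal_ofReal
      hσm.ennreal_ofReal hs (ae_restrict_of_ae_restrict_of_subset hp.subset hone)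
      (by simpa only [Measure.restrict_apply_univ] using
        hC _ (isCube_cornerCube p.1 hp.1) hp.subset) hcC
    rw [Measure.restrict_apply_univ, Measure.restrict_apply (measurableSet_lt measurable_const
      (hσm.ennreal_ofReal.mul_const _)), Set.inter_comm] at h1
    exact h1
  set L : ℝ := ((∫⁻ x in cornerCube a l, ENNReal.ofReal (σ x)) /
    volume (cornerCube a l)).toReal with hL
  refine exists_lintegral_rpow_lt_top hσm hσ0 hint (A := 2 * 5 ^ n) (L := L) (by positivity) hc0 hc1
    ENNReal.toReal_nonneg fun t ht => ?_
  have ht0 : 0 ≤ t := ENNReal.toReal_nonneg.trans ht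
  have htI : ∫⁻ x in cornerCube a l, ENNReal.ofReal (σ x) ≤
      ENNReal.ofReal t * volume (cornerCube a l) := by
    rw [← ENNReal.div_le_iff hK0 hKtop]
    exact (ENNReal.le_ofReal_iff_toReal_le (ENNReal.div_ne_top hint hK0) ht0).2 ht
  have hsup := lintegral_superlevel_le hl hσm.ennreal_ofReal hint hhalf htI
  have hlt : ∀ u : ℝ, 0 ≤ u → {x | ENNReal.ofReal u < ENNReal.ofReal (σ x)} = {x | u < σ x} :=
    fun u hu => by ext x; exact ENNReal.ofReal_lt_ofReal_iff_of_nonneg hu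
  rw [← ENNReal.ofReal_mul hc0.le, hlt t ht0, hlt (c * t) (by positivity)] at hsup
  rw [Measure.restrict_restrict (measurableSet_lt measurable_const hσm),
    Measure.restrict_apply (measurableSet_lt measurable_const hσm), Set.inter_comm,
    Set.inter_comm {x | c * t < σ x}]
  refine hsup.trans (le_of_eq ?_)
  rw [ENNReal.ofReal_mul (by positivity), ENNReal.ofReal_mul (by positivity),
    ENNReal.ofReal_pow (by positivity)]
  simp

theorem rpow_le_rpow_mul_add_rpow {f w p p₀ : ℝ} (hf : 0 ≤ f) (hw : 0 < w) (hp : 0 < p)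
    (hpp : p < p₀) : f ^ p ≤ f ^ p₀ * w + w ^ (-(p / (p₀ - p))) := by
  have hd : 0 < p₀ - p := by linarith
  rcases le_total 1 (f ^ (p₀ - p) * w) with h | h
  · calc f ^ p ≤ f ^ p * (f ^ (p₀ - p) * w) := le_mul_of_one_le_right (by positivity) h
      _ = f ^ p₀ * w := by
        rw [← mul_assoc, ← Real.rpow_add_of_nonneg hf hp.le hd.le, add_sub_cancel]
      _ ≤ _ := le_add_of_nonneg_right (by positivity)
  · have h1 : f ^ (p₀ - p) ≤ w⁻¹ := by
      rw [← one_div]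
      exact (le_div_iff₀ hw).2 h
    calc f ^ p = (f ^ (p₀ - p)) ^ (p / (p₀ - p)) := by
          rw [← Real.rpow_mul hf, mul_div_cancel₀ _ hd.ne']
      _ ≤ w⁻¹ ^ (p / (p₀ - p)) := Real.rpow_le_rpow (by positivity) h1 (by positivity)
      _ = w ^ (-(p / (p₀ - p))) := by rw [Real.rpow_neg hw.le, Real.inv_rpow hw.le]
      _ ≤ _ := le_add_of_nonneg_left (by positivity)

/-- A function in `L^{p₀}_w` with `w ∈ A_{p₀/r}` on a cube lies in some `L^p` with `p > r`. -/
theorem MemLw.exists_memLeb {n : ℕ} {Q : Set (Fin n → ℝ)} (hQ : IsCube Q) {r p₀ : ℝ}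
    (hr : 0 < r) (hrp : r < p₀) {w f : (Fin n → ℝ) → ℝ} (hw : MemA Q (p₀ / r) w)
    (hf : MemLw Q p₀ w f) : ∃ p, r < p ∧ MemLeb Q p f := by
  have hq : 1 < p₀ / r := (one_lt_div hr).2 hrp
  have hwq : MemApGT1 Q (p₀ / r) w := (hw.resolve_left fun h => hq.ne' h.1).2
  obtain ⟨a, l, hl, rfl⟩ := hQ.exists_eq_cornerCube
  obtain ⟨ε, hε, hσ⟩ := MemApGT1.exists_lintegral_dual_rpow_lt_top hl hq hwq
  have hd : 0 < p₀ - r := by linarith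
  have hp₀ : 0 < p₀ := hr.trans hrp
  set κ := (1 + ε) * r / (p₀ - r) with hκ
  have hκ0 : 0 < κ := by positivity
  set p := p₀ * κ / (1 + κ) with hp
  have hp0 : 0 < p := by positivity
  have hpd : p₀ - p = p₀ / (1 + κ) := by rw [hp]; field_simp; ring
  have hpp : p < p₀ := by
    have : 0 < p₀ / (1 + κ) := by positivity
    linarith
  have hpκ : p / (p₀ - p) = κ := by rw [hpd, hp]; field_simp
  have hrκ : r < κ * (p₀ - r) := by
    rw [hκ, div_mul_cancel₀ _ hd.ne']
    nlinarith
  refine ⟨p, ?_, hf.1, ?_⟩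
  · rw [hp, lt_div_iff₀ (by positivity)]
    linarith
  have hint : ∫⁻ x in cornerCube a l, ENNReal.ofReal |f x| ^ p ≤
      ∫⁻ x in cornerCube a l, (ENNReal.ofReal |f x| ^ p₀ * ENNReal.ofReal (w x) +
        ENNReal.ofReal (max (w x ^ (1 - p₀ / r / (p₀ / r - 1))) 0 ^ (1 + ε))) := by
    refine lintegral_mono_ae ?_
    filter_upwards [hwq.1.pos] with x hx
    have h1 : max (w x ^ (1 - p₀ / r / (p₀ / r - 1))) 0 ^ (1 + ε) = w x ^ (-(p / (p₀ - p))) := by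
      rw [max_eq_left (by positivity), ← Real.rpow_mul hx.le, hpκ, hκ]
      congr 1
      have : p₀ / r - 1 = (p₀ - r) / r := by field_simp
      rw [this]
      field_simp
      ring
    rw [h1, ENNReal.ofReal_rpow_of_nonneg (abs_nonneg _) hp0.le,
      ENNReal.ofReal_rpow_of_nonneg (abs_nonneg _) hp₀.le, ← ENNReal.ofReal_mul (by positivity),
      ← ENNReal.ofReal_add (by positivity) (by positivity)]
    exact ENNReal.ofReal_le_ofReal (rpow_le_rpow_mul_add_rpow (abs_nonneg _) hx hp0 hpp)
  simp only [ENNReal.ofReal_one, mul_one]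
  refine hint.trans_lt ?_
  have hm : Measurable fun x => ENNReal.ofReal |f x| ^ p₀ * ENNReal.ofReal (w x) :=
    (hf.1.abs.ennreal_ofReal.pow_const _).mul hwq.1.measurable.ennreal_ofReal
  rw [lintegral_add_left hm]
  exact ENNReal.add_lt_top.2 ⟨hf.2, hσ⟩

/-- The `A₁` condition bounds the average over any subcube by the pointwise value. -/
theorem MemA1.exists_average_le {n : ℕ} {Ω : Set (Fin n → ℝ)} {w : (Fin n → ℝ) → ℝ}
    (hw : MemA1 Ω w) : ∃ C : ℝ, 0 < C ∧ ∀ Q : Set (Fin n → ℝ), IsCube Q → Q ⊆ Ω →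
      ∀ᵐ x ∂volume.restrict Q,
        (volume Q)⁻¹ * ∫⁻ y in Q, ENNReal.ofReal (w y) ≤ ENNReal.ofReal (C * w x) := by
  obtain ⟨hwt, C, hC⟩ := hw
  refine ⟨max C 1, by positivity, fun Q hQ hQΩ => ?_⟩
  filter_upwards [ae_restrict_of_ae_restrict_of_subset hQΩ hC,
    ae_restrict_of_ae_restrict_of_subset hQΩ hwt.pos, ae_restrict_mem hQ.measurableSet]
    with x hx hpos hxQ
  calc (volume Q)⁻¹ * ∫⁻ y in Q, ENNReal.ofReal (w y)
      ≤ (volume Q)⁻¹ * ∫⁻ y in Q, ENNReal.ofReal |w y| := by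
        gcongr with y
        exact le_abs_self _
    _ ≤ maximal Ω w x := le_iSup₂_of_le Q hQ (le_iSup₂_of_le hQΩ hxQ le_rfl)
    _ ≤ ENNReal.ofReal (C * w x) := hx
    _ ≤ ENNReal.ofReal (max C 1 * w x) :=
        ENNReal.ofReal_le_ofReal (mul_le_mul_of_nonneg_right (le_max_left _ _) hpos.le)

/-- The negative power `w ^ (1 - q)` of an `A₁` weight is an `A_q` weight. -/
theorem MemA1.memApGT1_rpow {n : ℕ} {Ω : Set (Fin n → ℝ)} {w : (Fin n → ℝ) → ℝ}
    (hw : MemA1 Ω w) {q : ℝ} (hq : 1 < q) : MemApGT1 Ω q fun x => w x ^ (1 - q) := by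
  obtain ⟨C, hC0, hC⟩ := hw.exists_average_le
  have hs : 0 < q - 1 := by linarith
  have hbound : ∀ Q : Set (Fin n → ℝ), IsCube Q → Q ⊆ Ω → ∃ A : ℝ, 0 < A ∧
      (volume Q)⁻¹ * ∫⁻ y in Q, ENNReal.ofReal (w y) = ENNReal.ofReal A ∧
      ∀ᵐ x ∂volume.restrict Q, w x ^ (1 - q) ≤ (A / C) ^ (1 - q) := by
    intro Q hQ hQΩ
    have hQC := hC Q hQ hQΩ
    have hpos := ae_restrict_of_ae_restrict_of_subset hQΩ hw.1.pos
    have hfin : ∫⁻ y in Q, ENNReal.ofReal (w y) ≠ ∞ :=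
      ((hw.1.locInt Q hQ hQΩ).lintegral_lt_top).ne
    have hA0 : (volume Q)⁻¹ * ∫⁻ y in Q, ENNReal.ofReal (w y) ≠ 0 :=
      mul_ne_zero (ENNReal.inv_ne_zero.2 hQ.volume_ne_top) (hw.1.lintegral_ne_zero hQ hQΩ)
    have hAtop : (volume Q)⁻¹ * ∫⁻ y in Q, ENNReal.ofReal (w y) ≠ ∞ :=
      ENNReal.mul_ne_top (ENNReal.inv_ne_top.2 hQ.volume_ne_zero) hfin
    have hA := ENNReal.toReal_pos hA0 hAtop
    refine ⟨_, hA, (ENNReal.ofReal_toReal hAtop).symm, ?_⟩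
    filter_upwards [hQC, hpos] with x hx hx0
    refine Real.rpow_le_rpow_of_nonpos (by positivity) ?_ (by linarith)
    rw [div_le_iff₀' hC0]
    exact ENNReal.toReal_le_of_le_ofReal (by positivity) hx
  have hvm : Measurable fun x => w x ^ (1 - q) := hw.1.measurable.pow_const _
  refine ⟨⟨hvm, ?_, fun Q hQ hQΩ => ?_⟩, ENNReal.ofReal (C ^ (q - 1)), ENNReal.ofReal_ne_top,
    fun Q hQ hQΩ => ?_⟩
  · filter_upwards [hw.1.pos] with x hx
    positivity
  · obtain ⟨A, hA, -, hle⟩ := hbound Q hQ hQΩ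
    have hpos := ae_restrict_of_ae_restrict_of_subset hQΩ hw.1.pos
    refine Measure.integrableOn_of_bounded (M := (A / C) ^ (1 - q))
      hQ.volume_ne_top hvm.aestronglyMeasurable ?_
    filter_upwards [hle, hpos] with x hx hx0
    rwa [Real.norm_of_nonneg (by positivity)]
  · obtain ⟨A, hA, hAeq, hle⟩ := hbound Q hQ hQΩ
    have hpos := ae_restrict_of_ae_restrict_of_subset hQΩ hw.1.pos
    have hdual : ∫⁻ x in Q, ENNReal.ofReal ((w x ^ (1 - q)) ^ (1 - q / (q - 1))) =
        ∫⁻ x in Q, ENNReal.ofReal (w x) := by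
      refine lintegral_congr_ae ?_
      filter_upwards [hpos] with x hx
      have hexp : (1 - q) * (1 - q / (q - 1)) = 1 := by
        field_simp
        ring
      rw [← Real.rpow_mul hx.le, hexp, Real.rpow_one]
    have hV : (volume Q)⁻¹ * ∫⁻ x in Q, ENNReal.ofReal (w x ^ (1 - q)) ≤
        ENNReal.ofReal ((A / C) ^ (1 - q)) := by
      rw [ENNReal.inv_mul_le_iff hQ.volume_ne_zero hQ.volume_ne_top,
        mul_comm, ← setLIntegral_const]
      refine lintegral_mono_ae ?_
      filter_upwards [hle] with x hx using ENNReal.ofReal_le_ofReal hx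
    rw [hdual, hAeq, ENNReal.ofReal_rpow_of_pos hA]
    refine (mul_le_mul_left hV _).trans (le_of_eq ?_)
    rw [← ENNReal.ofReal_mul (by positivity)]
    congr 1
    rw [Real.div_rpow hA.le hC0.le, div_mul_eq_mul_div, ← Real.rpow_add hA,
      show 1 - q + (q - 1) = 0 by ring, Real.rpow_zero, one_div, ← Real.rpow_neg hC0.le, neg_sub]

/-- A function whose `r`-th power has an `A₁` majorant on a cube lies in some `L^{p₀}_w` with
`w ∈ A_{p₀/r}`. -/
theorem HasApPowMajorant.exists_memLw {n : ℕ} {Q : Set (Fin n → ℝ)} (hQ : IsCube Q) {r p₀ : ℝ}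
    (hr : 0 < r) (hrp : r < p₀) {f : (Fin n → ℝ) → ℝ} (hf : HasApPowMajorant Q 1 r f) :
    ∃ w, MemA Q (p₀ / r) w ∧ MemLw Q p₀ w f := by
  obtain ⟨hfm, w, hw, hfw⟩ := hf
  have hw1 : MemA1 Q w := (hw.resolve_right fun h => lt_irrefl _ h.1).2
  have hq : 1 < p₀ / r := (one_lt_div hr).2 hrp
  refine ⟨fun x => w x ^ (1 - p₀ / r), Or.inr ⟨hq, hw1.memApGT1_rpow hq⟩, hfm, ?_⟩
  refine lt_of_le_of_lt (lintegral_mono_ae ?_) (hw1.1.locInt Q hQ subset_rfl).lintegral_lt_top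
  filter_upwards [hfw, hw1.1.pos] with x hx hx0
  have hp₀ : 0 < p₀ := hr.trans hrp
  rw [ENNReal.ofReal_rpow_of_nonneg (abs_nonneg _) hp₀.le, ← ENNReal.ofReal_mul (by positivity)]
  refine ENNReal.ofReal_le_ofReal ?_
  calc |f x| ^ p₀ * w x ^ (1 - p₀ / r)
      = (|f x| ^ r) ^ (p₀ / r) * w x ^ (1 - p₀ / r) := by
        rw [← Real.rpow_mul (abs_nonneg _), mul_div_cancel₀ _ hr.ne']
    _ ≤ w x ^ (p₀ / r) * w x ^ (1 - p₀ / r) := by gcongr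
    _ = w x := by rw [← Real.rpow_add hx0, add_sub_cancel, Real.rpow_one]

/-- On a cube, `L^p` functions with `p > r` have an `A₁` majorant of their `r`-th power. -/
theorem MemLeb.hasApPowMajorant {n : ℕ} {Q : Set (Fin n → ℝ)} (hQ : IsCube Q) {r p : ℝ}
    (hr : 0 < r) (hrp : r < p) {f : (Fin n → ℝ) → ℝ} (hf : MemLeb Q p f) :
    HasApPowMajorant Q 1 r f := by
  have hp : 0 < p := hr.trans hrp
  obtain ⟨hfm, hfi⟩ := hf
  simp only [ENNReal.ofReal_one, mul_one] at hfi
  have hQm := hQ.measurableSet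
  set h : (Fin n → ℝ) → ℝ≥0∞ := Q.indicator fun x => ENNReal.ofReal |f x| ^ p + 1 with hh
  have hm : Measurable h := ((hfm.abs.ennreal_ofReal.pow_const _).add_const _).indicator hQm
  have hint : ∫⁻ x, h x ≠ ∞ := by
    rw [hh, lintegral_indicator hQm, lintegral_add_right _ measurable_const]
    simp [hfi.ne, hQ.volume_ne_top]
  have hδ : 0 < r / p := by positivity
  have hδ1 : r / p < 1 := (div_lt_one hp).2 hrp
  obtain ⟨C, hC0, hC⟩ := exists_lintegral_ballMaximal_rpow_le (h := h) hδ hδ1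
  set u := ballMaximal h with hu
  have hum : Measurable u := measurable_ballMaximal h
  have hutop : ∀ᵐ x ∂volume.restrict Q, u x ≠ ∞ :=
    ae_restrict_of_ae ((ae_ballMaximal_lt_top hint).mono fun _ hx => hx.ne)
  have hule : ∀ᵐ x ∂volume.restrict Q, ENNReal.ofReal |f x| ^ p + 1 ≤ u x := by
    filter_upwards [ae_restrict_of_ae (ae_le_ballMaximal hm hint), ae_restrict_mem hQm]
      with x hx hxQ
    rwa [hh, Set.indicator_of_mem hxQ] at hx
  set w : (Fin n → ℝ) → ℝ := fun x => (u x).toReal ^ (r / p) with hwdef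
  have hwm : Measurable w := hum.ennreal_toReal.pow_const _
  have hwu : ∀ x, u x ≠ ∞ → ENNReal.ofReal (w x) = u x ^ (r / p) := fun x hx => by
    rw [hwdef, ← ENNReal.ofReal_rpow_of_nonneg ENNReal.toReal_nonneg hδ.le,
      ENNReal.ofReal_toReal hx]
  have hpos : ∀ᵐ x ∂volume.restrict Q, 0 < w x := by
    filter_upwards [hutop, hule] with x hx hx1
    have : 0 < (u x).toReal :=
      ENNReal.toReal_pos (one_pos.trans_le (le_add_self.trans hx1)).ne' hx
    exact Real.rpow_pos_of_pos this _
  have havg : ∀ Q' : Set (Fin n → ℝ), IsCube Q' → Q' ⊆ Q → ∀ x ∈ Q', u x ≠ 0 → u x ≠ ∞ →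
      (volume Q')⁻¹ * ∫⁻ y in Q', ENNReal.ofReal |w y| ≤ ENNReal.ofReal (C * w x) := by
    intro Q' hQ' hQQ' x hx hx0 hxtop
    have hwe : ∫⁻ y in Q', ENNReal.ofReal |w y| = ∫⁻ y in Q', u y ^ (r / p) := by
      refine lintegral_congr_ae ?_
      filter_upwards [ae_restrict_of_ae_restrict_of_subset hQQ' hutop] with y hy
      rw [abs_of_nonneg (Real.rpow_nonneg ENNReal.toReal_nonneg _), hwu y hy]
    rw [hwe, ENNReal.inv_mul_le_iff hQ'.volume_ne_zero hQ'.volume_ne_top, ENNReal.ofReal_mul hC0,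
      hwu x hxtop]
    obtain ⟨a, s, hs, rfl⟩ := hQ'.exists_eq_cornerCube
    rw [cornerCube_eq_closedBall a hs] at hx ⊢
    refine (hC _ _ (by positivity) x hx hx0 hxtop).trans (le_of_eq ?_)
    ring
  have hgood : ∀ᵐ x ∂volume.restrict Q, x ∈ Q ∧ u x ≠ 0 ∧ u x ≠ ∞ := by
    filter_upwards [hutop, hule, ae_restrict_mem hQm] with x hx hx1 hxQ
    exact ⟨hxQ, (one_pos.trans_le (le_add_self.trans hx1)).ne', hx⟩
  refine ⟨hfm, w, Or.inl ⟨rfl, ⟨hwm, hpos, fun Q' hQ' hQQ' => ?_⟩, C, ?_⟩, ?_⟩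
  · refine ⟨hwm.aestronglyMeasurable, ?_⟩
    have hmem := ae_restrict_of_ae_restrict_of_subset hQQ' hgood
    have hne : volume.restrict Q' ≠ 0 := by
      rw [Ne, Measure.restrict_eq_zero]
      exact hQ'.volume_ne_zero
    have : (ae (volume.restrict Q')).NeBot := ae_neBot.2 hne
    obtain ⟨x, hx, hxQ⟩ := (hmem.and (ae_restrict_mem hQ'.measurableSet)).exists
    have h1 := (havg Q' hQ' hQQ' x hxQ hx.2.1 hx.2.2).trans_lt ENNReal.ofReal_lt_top
    rw [HasFiniteIntegral]
    simp only [← ofReal_norm, Real.norm_eq_abs]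
    refine lt_top_iff_ne_top.2 fun htop => h1.ne ?_
    rw [htop]
    exact ENNReal.mul_top (ENNReal.inv_ne_zero.2 hQ'.volume_ne_top)
  · filter_upwards [hgood] with x hx
    exact iSup₂_le fun Q' hQ' => iSup₂_le fun hQQ' hxQ' =>
      havg Q' hQ' hQQ' x hxQ' hx.2.1 hx.2.2
  · filter_upwards [hutop, hule] with x hx hx1
    have h1 : |f x| ^ p ≤ (u x).toReal := by
      rw [← ENNReal.ofReal_le_iff_le_toReal hx,
        ← ENNReal.ofReal_rpow_of_nonneg (abs_nonneg _) hp.le]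
      exact le_self_add.trans hx1
    calc |f x| ^ r = (|f x| ^ p) ^ (r / p) := by
          rw [← Real.rpow_mul (abs_nonneg _), mul_div_cancel₀ _ hp.ne']
      _ ≤ w x := Real.rpow_le_rpow (by positivity) h1 hδ.le

theorem stmt1 (n : ℕ) (Q : Set (Fin n → ℝ)) (hQ : IsCube Q) (r p₀ : ℝ)
    (hr : 0 < r) (hrp : r < p₀) :
    {f : (Fin n → ℝ) → ℝ | HasApPowMajorant Q 1 r f} =
      {f | ∃ p, r < p ∧ MemLeb Q p f} ∧
    {f : (Fin n → ℝ) → ℝ | ∃ p, r < p ∧ MemLeb Q p f} =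
      {f | ∃ w, MemA Q (p₀ / r) w ∧ MemLw Q p₀ w f} := by
  have h13 : ∀ f : (Fin n → ℝ) → ℝ, HasApPowMajorant Q 1 r f →
      ∃ w, MemA Q (p₀ / r) w ∧ MemLw Q p₀ w f := fun f hf => hf.exists_memLw hQ hr hrp
  have h32 : ∀ f : (Fin n → ℝ) → ℝ, (∃ w, MemA Q (p₀ / r) w ∧ MemLw Q p₀ w f) →
      ∃ p, r < p ∧ MemLeb Q p f := fun f ⟨_, hw, hf⟩ => hf.exists_memLeb hQ hr hrp hw
  have h21 : ∀ f : (Fin n → ℝ) → ℝ, (∃ p, r < p ∧ MemLeb Q p f) →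
      HasApPowMajorant Q 1 r f := fun f ⟨_, hp, hf⟩ => hf.hasApPowMajorant hQ hr hp
  exact ⟨Set.ext fun f => ⟨fun hf => h32 f (h13 f hf), h21 f⟩,
    Set.ext fun f => ⟨fun hf => h13 f (h21 f hf), h32 f⟩⟩
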